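/- The pairing K × A/AB⁺ → ℂ induced by the Hopf pairing between U and A is nondegenerate. -/

import Mathlib

noncomputable section

open scoped TensorProduct

variable {U A : Type} [Ring U] [HopfAlgebra ℂ U] [Ring A] [HopfAlgebra ℂ A]

/-- For a pairing `pair : U × A → ℂ` and `k : U`, the operator
`a ↦ ⟨k, a₍₁₎⟩ a₍₂₎` on `A`. -/
def hitL (pair : U →ₗ[ℂ] A →ₗ[ℂ] ℂ) (k : U) : A →ₗ[ℂ] A :=
  TensorProduct.lift ((LinearMap.lsmul ℂ A).comp (pair k)) ∘ₗ Coalgebra.comul (R := ℂ)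

/-- The subspace `B = {b ∈ A | ⟨k, b₍₁₎⟩ b₍₂₎ = 0 for all k ∈ K⁺}` of invariants. -/
def invSubmodule (pair : U →ₗ[ℂ] A →ₗ[ℂ] ℂ) (K : Subalgebra ℂ U) : Submodule ℂ A :=
  ⨅ k : ↥K,
    LinearMap.ker (hitL pair ((k : U) - algebraMap ℂ U (Coalgebra.counit (R := ℂ) (k : U))))

/-- The subspace `A·B⁺ ⊆ A`. -/
def ABp (Bsub : Subalgebra ℂ A) : Submodule ℂ A :=
  Submodule.span ℂ
    {x : A | ∃ a : A, ∃ b ∈ Bsub, Coalgebra.counit (R := ℂ) b = 0 ∧ x = a * b}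

/-- The map `Δ̄ : B → A ⊗ Ā`, where `Ā = A/AB⁺`, given by the comultiplication of `A`
followed by the canonical projection in the second tensor factor. -/
def DbarB (Bsub : Subalgebra ℂ A) :
    ↥Bsub →ₗ[ℂ] A ⊗[ℂ] (A ⧸ ABp Bsub) :=
  (TensorProduct.map LinearMap.id (ABp Bsub).mkQ) ∘ₗ (Coalgebra.comul (R := ℂ)) ∘ₗ
    Bsub.val.toLinearMap

/-- The counit of `A` restricted to the subalgebra `B`. -/
def counitB (Bsub : Subalgebra ℂ A) : Module.Dual ℂ ↥Bsub :=
  (Coalgebra.counit (R := ℂ) (A := A)) ∘ₗ Bsub.val.toLinearMap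

/-- The augmentation ideal `B⁺ = B ∩ ker ε` of `B`. -/
def BplusB (Bsub : Subalgebra ℂ A) : Submodule ℂ ↥Bsub :=
  LinearMap.ker (counitB Bsub)

/-- `Δ̄(I) ⊆ I ⊗ Ā`. -/
def DbarStable (Bsub : Subalgebra ℂ A) (I : Submodule ℂ ↥Bsub) : Prop :=
  ∀ x ∈ I, DbarB Bsub x ∈
    LinearMap.range (TensorProduct.map (Bsub.val.toLinearMap ∘ₗ I.subtype)
      (LinearMap.id (R := ℂ) (M := A ⧸ ABp Bsub)))

/-- Membership in the dual coalgebra `B°` of `B`: a functional `f ∈ B'` lies in `B°`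
iff `(a,b) ↦ f(ab)` admits a finite decomposition `f(ab) = Σᵢ gᵢ(a) hᵢ(b)`. -/
def IsDualCoalgElemB (Bsub : Subalgebra ℂ A) (f : Module.Dual ℂ ↥Bsub) : Prop :=
  ∃ (n : ℕ) (g h : Fin n → Module.Dual ℂ ↥Bsub),
    ∀ a b : ↥Bsub, f (a * b) = ∑ i, g i a * h i b

/-- `Δ(T) ⊆ B° ⊗ T` for a subspace `T` of `B'` consisting of elements of `B°`. -/
def DeltaInto (Bsub : Subalgebra ℂ A) (T : Submodule ℂ (Module.Dual ℂ ↥Bsub)) : Prop :=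
  ∀ f ∈ T, ∃ (n : ℕ) (g h : Fin n → Module.Dual ℂ ↥Bsub),
    (∀ i, IsDualCoalgElemB Bsub (g i)) ∧ (∀ i, h i ∈ T) ∧
    ∀ a b : ↥Bsub, f (a * b) = ∑ i, g i a * h i b

/-- `g` is the result of the right action of `k ∈ K ⊆ U` on the functional `f ∈ B'`:
`g(b) = f(b₍₀₎) ⟨k, b₍₁₎⟩`, where `Δ(b) = b₍₀₎ ⊗ b₍₁₎ ∈ B ⊗ A` (which represents the
coaction `B → B ⊗ Ā`; note that `k ∈ K` descends to `Ā = A/AB⁺`). -/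
def IsDualAct (pair : U →ₗ[ℂ] A →ₗ[ℂ] ℂ) (Bsub : Subalgebra ℂ A)
    (f : Module.Dual ℂ ↥Bsub) (k : U) (g : Module.Dual ℂ ↥Bsub) : Prop :=
  ∀ (b : ↥Bsub) (c : ↥Bsub ⊗[ℂ] A),
    TensorProduct.map Bsub.val.toLinearMap LinearMap.id c =
      Coalgebra.comul (R := ℂ) (b : A) →
    g b = TensorProduct.lift (((LinearMap.mul ℂ ℂ) ∘ₗ f).compl₂ (pair k)) c

/-- `T` is stable under the right action of `K` on `B'`. -/
def KStable (pair : U →ₗ[ℂ] A →ₗ[ℂ] ℂ) (K : Subalgebra ℂ U) (Bsub : Subalgebra ℂ A)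
    (T : Submodule ℂ (Module.Dual ℂ ↥Bsub)) : Prop :=
  ∀ f ∈ T, ∀ k ∈ K, ∀ g : Module.Dual ℂ ↥Bsub, IsDualAct pair Bsub f k g → g ∈ T

/-- The annihilator `T_I ⊆ B'` of a subspace `I ⊆ B`. -/
def TofI (Bsub : Subalgebra ℂ A) (I : Submodule ℂ ↥Bsub) :
    Submodule ℂ (Module.Dual ℂ ↥Bsub) :=
  ⨅ x : ↥I, LinearMap.ker (Module.Dual.eval ℂ ↥Bsub (x : ↥Bsub))

/-- The common kernel `I_T ⊆ B` of a subspace `T ⊆ B'`. -/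
def IofT (Bsub : Subalgebra ℂ A) (T : Submodule ℂ (Module.Dual ℂ ↥Bsub)) :
    Submodule ℂ ↥Bsub :=
  ⨅ f : ↥T, LinearMap.ker (f : Module.Dual ℂ ↥Bsub)



section LeftCoideal

/-- Every element of a coalgebra lies in a finite-dimensional left coideal; `m` is the matrix of
coefficients with respect to the basis `e` of that coideal. -/
lemma exists_matrix_coefficients (a : A) :
    ∃ (n : ℕ) (e : Fin n → A) (m : Matrix (Fin n) (Fin n) A) (x : Fin n → ℂ),
      a = ∑ i, x i • e i ∧
      (∀ i, Coalgebra.comul (R := ℂ) (e i) = ∑ j, m i j ⊗ₜ[ℂ] e j) ∧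
      (∀ i j, Coalgebra.comul (R := ℂ) (m i j) = ∑ l, m i l ⊗ₜ[ℂ] m l j) ∧
      ∀ i j, Coalgebra.counit (R := ℂ) (m i j) = if i = j then 1 else 0 := by
  classical
  let b := Module.Basis.ofVectorSpace ℂ A
  let y := TensorProduct.equivFinsuppOfBasisLeft (N := A) b (Coalgebra.comul (R := ℂ) a)
  have hy : Coalgebra.comul (R := ℂ) a = ∑ s ∈ y.support, b s ⊗ₜ[ℂ] y s := by
    rw [← LinearEquiv.symm_apply_apply (TensorProduct.equivFinsuppOfBasisLeft (N := A) b)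
      (Coalgebra.comul (R := ℂ) a), TensorProduct.equivFinsuppOfBasisLeft_symm_apply]
    rfl
  let D : Submodule ℂ A := Submodule.span ℂ (y '' y.support)
  have hyD : ∀ s ∈ y.support, y s ∈ D := fun s hs =>
    Submodule.subset_span ⟨s, hs, rfl⟩
  have : FiniteDimensional ℂ D :=
    FiniteDimensional.span_of_finite ℂ (y.support.finite_toSet.image _)
  have haD : a ∈ D := by
    have h := Coalgebra.rTensor_counit_comul (R := ℂ) a
    rw [hy, map_sum] at h
    have h2 := congrArg (TensorProduct.lid ℂ A) h
    simp only [map_sum, LinearMap.rTensor_tmul, TensorProduct.lid_tmul, one_smul] at h2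
    rw [← h2]
    exact D.sum_mem fun s hs => D.smul_mem _ (hyD s hs)
  have hslice : ∀ i, Coalgebra.comul (R := ℂ) (y i) ∈
      LinearMap.range (D.subtype.lTensor A) := by
    intro i
    have h1 : y i = TensorProduct.lid ℂ A ((b.coord i).rTensor A (Coalgebra.comul (R := ℂ) a)) :=
      TensorProduct.equivFinsuppOfBasisLeft_apply b _ i
    have h2 : ∀ z : A ⊗[ℂ] A, Coalgebra.comul (R := ℂ)
        (TensorProduct.lid ℂ A ((b.coord i).rTensor A z)) =
        TensorProduct.lid ℂ (A ⊗[ℂ] A) ((b.coord i).rTensor (A ⊗[ℂ] A)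
          (Coalgebra.comul.lTensor A z)) := by
      intro z
      induction z with
      | zero => simp
      | add p q hp hq => simp only [map_add, hp, hq]
      | tmul p q => simp
    have h3 : ∀ (z : A ⊗[ℂ] A) (w : A), TensorProduct.lid ℂ (A ⊗[ℂ] A)
        ((b.coord i).rTensor (A ⊗[ℂ] A) (TensorProduct.assoc ℂ A A A (z ⊗ₜ[ℂ] w))) =
        TensorProduct.lid ℂ A ((b.coord i).rTensor A z) ⊗ₜ[ℂ] w := by
      intro z w
      induction z with
      | zero => simp
      | add p q hp hq => simp only [map_add, TensorProduct.add_tmul, hp, hq]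
      | tmul p q => simp [TensorProduct.smul_tmul']
    rw [h1, h2, ← Coalgebra.coassoc_apply, hy]
    simp only [map_sum, LinearMap.rTensor_tmul, h3]
    refine Submodule.sum_mem _ fun s hs => ?_
    exact ⟨_ ⊗ₜ[ℂ] ⟨y s, hyD s hs⟩, LinearMap.lTensor_tmul _ _ _ _⟩
  have hD : ∀ d ∈ D, Coalgebra.comul (R := ℂ) d ∈ LinearMap.range (D.subtype.lTensor A) := by
    intro d hd
    have : D ≤ (LinearMap.range (D.subtype.lTensor A)).comap (Coalgebra.comul (R := ℂ)) := by
      refine Submodule.span_le.2 ?_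
      rintro _ ⟨s, -, rfl⟩
      exact hslice s
    exact this hd
  let e := Module.finBasis ℂ D
  choose t ht using fun i => hD (e i) (e i).2
  let m : Matrix (Fin (Module.finrank ℂ D)) (Fin (Module.finrank ℂ D)) A := fun i =>
    TensorProduct.equivFinsuppOfBasisRight (M := A) e (t i)
  have he : ∀ i, Coalgebra.comul (R := ℂ) (e i : A) = ∑ j, m i j ⊗ₜ[ℂ] (e j : A) := by
    intro i
    have h : t i = ∑ j, m i j ⊗ₜ[ℂ] e j := by
      rw [← LinearEquiv.symm_apply_apply (TensorProduct.equivFinsuppOfBasisRight (M := A) e)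
        (t i), TensorProduct.equivFinsuppOfBasisRight_symm_apply, Finsupp.sum_fintype _ _ (by simp)]
    rw [← ht, h]
    simp
  have hsum : ∀ (M : Type) [AddCommGroup M] [Module ℂ M]
      (f g : Fin (Module.finrank ℂ D) → M),
      ∑ j, f j ⊗ₜ[ℂ] (e j : A) = ∑ j, g j ⊗ₜ[ℂ] (e j : A) → f = g := by
    intro M _ _ f g h
    have hinj := Module.Flat.lTensor_preserves_injective_linearMap (M := M) D.subtype
      D.injective_subtype
    have h' : ∑ j, f j ⊗ₜ[ℂ] e j = ∑ j, g j ⊗ₜ[ℂ] e j := hinj (by simpa using h)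
    have h2 := congrArg (TensorProduct.equivFinsuppOfBasisRight (M := M) e) h'
    funext j
    have h3 := DFunLike.congr_fun h2 j
    simpa [Finsupp.finsetSum_apply, TensorProduct.equivFinsuppOfBasisRight_apply_tmul_apply,
      Finsupp.single_apply] using h3
  refine ⟨_, fun i => e i, m, fun i => e.repr ⟨a, haD⟩ i, ?_, he, ?_, ?_⟩
  · have h := congrArg D.subtype (e.sum_repr ⟨a, haD⟩)
    rw [map_sum] at h
    exact h.symm
  · intro i j
    refine congrFun (hsum (A ⊗[ℂ] A) (fun j => Coalgebra.comul (R := ℂ) (m i j))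
      (fun j => ∑ l, m i l ⊗ₜ[ℂ] m l j) ?_) j
    have h := Coalgebra.coassoc_symm_apply (R := ℂ) (e i : A)
    simp only [he, map_sum, LinearMap.lTensor_tmul, LinearMap.rTensor_tmul,
      TensorProduct.tmul_sum, TensorProduct.assoc_symm_tmul] at h
    rw [← h, Finset.sum_comm]
    simp only [TensorProduct.sum_tmul]
  · intro i j
    refine congrFun (hsum ℂ (fun j => Coalgebra.counit (R := ℂ) (m i j))
      (fun j => if i = j then 1 else 0) ?_) j
    have h := Coalgebra.rTensor_counit_comul (R := ℂ) (e i : A)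
    simp only [he, map_sum, LinearMap.rTensor_tmul] at h
    simp [h, TensorProduct.ite_tmul]

variable {n : ℕ} {m : Matrix (Fin n) (Fin n) A}

lemma sum_antipode_mul_coefficient
    (hm : ∀ i j, Coalgebra.comul (R := ℂ) (m i j) = ∑ l, m i l ⊗ₜ[ℂ] m l j)
    (hε : ∀ i j, Coalgebra.counit (R := ℂ) (m i j) = if i = j then 1 else 0) (i j : Fin n) :
    ∑ l, HopfAlgebra.antipode ℂ (m i l) * m l j = if i = j then 1 else 0 := by
  have h := HopfAlgebra.mul_antipode_rTensor_comul_apply (R := ℂ) (m i j)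
  rw [hm, hε] at h
  simpa [apply_ite (algebraMap ℂ A)] using h

lemma sum_coefficient_mul_antipode
    (hm : ∀ i j, Coalgebra.comul (R := ℂ) (m i j) = ∑ l, m i l ⊗ₜ[ℂ] m l j)
    (hε : ∀ i j, Coalgebra.counit (R := ℂ) (m i j) = if i = j then 1 else 0) (i j : Fin n) :
    ∑ l, m i l * HopfAlgebra.antipode ℂ (m l j) = if i = j then 1 else 0 := by
  have h := HopfAlgebra.mul_antipode_lTensor_comul_apply (R := ℂ) (m i j)
  rw [hm, hε] at h
  simpa [apply_ite (algebraMap ℂ A)] using h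

/-- The antipode is anticomultiplicative on the entries of a comultiplicative matrix. -/
lemma comul_antipode_coefficient
    (hm : ∀ i j, Coalgebra.comul (R := ℂ) (m i j) = ∑ l, m i l ⊗ₜ[ℂ] m l j)
    (hε : ∀ i j, Coalgebra.counit (R := ℂ) (m i j) = if i = j then 1 else 0) (i j : Fin n) :
    Coalgebra.comul (R := ℂ) (HopfAlgebra.antipode ℂ (m i j)) =
      ∑ l, HopfAlgebra.antipode ℂ (m l j) ⊗ₜ[ℂ] HopfAlgebra.antipode ℂ (m i l) := by
  let S : Matrix (Fin n) (Fin n) A := m.map (HopfAlgebra.antipode ℂ)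
  have hSm : S * m = 1 := by
    ext i j
    simpa [Matrix.mul_apply, Matrix.one_apply, S] using sum_antipode_mul_coefficient hm hε i j
  have hmS : m * S = 1 := by
    ext i j
    simpa [Matrix.mul_apply, Matrix.one_apply, S] using sum_coefficient_mul_antipode hm hε i j
  let Δ : A →ₐ[ℂ] A ⊗[ℂ] A := Bialgebra.comulAlgHom ℂ A
  let ι₁ : A →ₐ[ℂ] A ⊗[ℂ] A := Algebra.TensorProduct.includeLeft
  let ι₂ : A →ₐ[ℂ] A ⊗[ℂ] A := Algebra.TensorProduct.includeRight
  have hΔ : Δ.mapMatrix m = ι₁.mapMatrix m * ι₂.mapMatrix m := by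
    ext i j
    simp [Matrix.mul_apply, Δ, ι₁, ι₂, hm]
  have hl : Δ.mapMatrix S * Δ.mapMatrix m = 1 := by rw [← map_mul, hSm, map_one]
  have hr : Δ.mapMatrix m * (ι₂.mapMatrix S * ι₁.mapMatrix S) = 1 := by
    rw [hΔ, mul_assoc, ← mul_assoc (ι₂.mapMatrix m), ← map_mul, hmS, map_one, one_mul, ← map_mul,
      hmS, map_one]
  have h := congrArg (fun M => M i j) (left_inv_eq_right_inv hl hr)
  simpa [Matrix.mul_apply, Δ, ι₁, ι₂, S] using h

end LeftCoideal

section Hit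

variable (pair : U →ₗ[ℂ] A →ₗ[ℂ] ℂ)

lemma hitL_of_comul_eq (u : U) {x : A} {ι : Type} (s : Finset ι) (f g : ι → A)
    (h : Coalgebra.comul (R := ℂ) x = ∑ i ∈ s, f i ⊗ₜ[ℂ] g i) :
    hitL pair u x = ∑ i ∈ s, pair u (f i) • g i := by
  simp [hitL, h]

lemma hitL_sub_algebraMap
    (hpair_oneU : ∀ a : A, pair 1 a = Coalgebra.counit (R := ℂ) a) (u : U) (c : ℂ) (x : A) :
    hitL pair (u - algebraMap ℂ U c) x = hitL pair u x - c • x := by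
  let r := Coalgebra.Repr.arbitrary ℂ x
  rw [hitL_of_comul_eq pair _ r.index _ _ r.eq.symm, hitL_of_comul_eq pair _ r.index _ _ r.eq.symm]
  have h := congrArg (c • ·) (Coalgebra.sum_counit_smul r)
  simp only [Finset.smul_sum, smul_smul] at h
  simp [Algebra.algebraMap_eq_smul_one, hpair_oneU, sub_smul, h]

lemma pair_hitL
    (hpair_mulU : ∀ (x y : U) (a : A), pair (x * y) a =
      LinearMap.mul' ℂ ℂ (TensorProduct.map (pair x) (pair y) (Coalgebra.comul (R := ℂ) a)))
    (u v : U) (x : A) : pair v (hitL pair u x) = pair (u * v) x := by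
  let r := Coalgebra.Repr.arbitrary ℂ x
  rw [hitL_of_comul_eq pair _ r.index _ _ r.eq.symm, hpair_mulU, ← r.eq]
  simp

lemma hitL_mul
    (hpair_mulA : ∀ (x : U) (a b : A), pair x (a * b) =
      LinearMap.mul' ℂ ℂ (TensorProduct.map (pair.flip a) (pair.flip b)
        (Coalgebra.comul (R := ℂ) x)))
    (u : U) {ι : Type} (s : Finset ι) (f g : ι → U)
    (h : Coalgebra.comul (R := ℂ) u = ∑ i ∈ s, f i ⊗ₜ[ℂ] g i) (x y : A) :
    hitL pair u (x * y) = ∑ i ∈ s, hitL pair (f i) x * hitL pair (g i) y := by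
  let p := Coalgebra.Repr.arbitrary ℂ x
  let q := Coalgebra.Repr.arbitrary ℂ y
  have hxy : Coalgebra.comul (R := ℂ) (x * y) = ∑ i ∈ p.index ×ˢ q.index,
      (p.left i.1 * q.left i.2) ⊗ₜ[ℂ] (p.right i.1 * q.right i.2) := by
    rw [Bialgebra.comul_mul, ← p.eq, ← q.eq, Finset.sum_mul_sum, Finset.sum_product]
    simp
  rw [hitL_of_comul_eq pair _ _ _ _ hxy]
  simp only [hitL_of_comul_eq pair _ p.index _ _ p.eq.symm,
    hitL_of_comul_eq pair _ q.index _ _ q.eq.symm, hpair_mulA, h, Finset.sum_mul_sum]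
  simp only [map_sum, TensorProduct.map_tmul, LinearMap.flip_apply, LinearMap.mul'_apply,
    Finset.sum_smul, smul_mul_smul_comm]
  rw [Finset.sum_comm]
  simp only [Finset.sum_product]

end Hit

section Equivariant

variable {n : ℕ} {m : Matrix (Fin n) (Fin n) A} (pair : U →ₗ[ℂ] A →ₗ[ℂ] ℂ)

/-- The representation of `U` on `ℂⁿ` whose matrix coefficients are the entries of a
comultiplicative matrix. -/
def coefficientRep
    (hpair_mulU : ∀ (x y : U) (a : A), pair (x * y) a =
      LinearMap.mul' ℂ ℂ (TensorProduct.map (pair x) (pair y) (Coalgebra.comul (R := ℂ) a)))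
    (hpair_oneU : ∀ a : A, pair 1 a = Coalgebra.counit (R := ℂ) a)
    (hm : ∀ i j, Coalgebra.comul (R := ℂ) (m i j) = ∑ l, m i l ⊗ₜ[ℂ] m l j)
    (hε : ∀ i j, Coalgebra.counit (R := ℂ) (m i j) = if i = j then 1 else 0) :
    U →ₐ[ℂ] Module.End ℂ (Fin n → ℂ) :=
  (Matrix.toLinAlgEquiv' : Matrix (Fin n) (Fin n) ℂ ≃ₐ[ℂ] _).toAlgHom.comp <|
    AlgHom.ofLinearMap
      { toFun := fun u => Matrix.of fun i j => pair u (m i j)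
        map_add' := fun u v => by ext; simp
        map_smul' := fun c u => by ext; simp }
      (by ext; simp [hpair_oneU, hε, Matrix.one_apply])
      (by intro u v; ext; simp [hpair_mulU, hm, Matrix.mul_apply])

/-- A family `f` in `A` which transforms under `K` by a comultiplicative matrix `m` and on which
the counit vanishes lies in `A·B⁺`. -/
lemma mem_ABp_of_equivariant
    (hpair_mulA : ∀ (x : U) (a b : A), pair x (a * b) =
      LinearMap.mul' ℂ ℂ (TensorProduct.map (pair.flip a) (pair.flip b)
        (Coalgebra.comul (R := ℂ) x)))
    (hpair_oneU : ∀ a : A, pair 1 a = Coalgebra.counit (R := ℂ) a)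
    (hpair_oneA : ∀ x : U, pair x 1 = Coalgebra.counit (R := ℂ) x)
    (K : Subalgebra ℂ U)
    (hKcoideal : ∀ k ∈ K, Coalgebra.comul (R := ℂ) k ∈
      LinearMap.range (TensorProduct.map (LinearMap.id (R := ℂ) (M := U))
        (Subalgebra.toSubmodule K).subtype))
    (Bsub : Subalgebra ℂ A)
    (hB : Subalgebra.toSubmodule Bsub = invSubmodule pair K)
    (hm : ∀ i j, Coalgebra.comul (R := ℂ) (m i j) = ∑ l, m i l ⊗ₜ[ℂ] m l j)
    (hε : ∀ i j, Coalgebra.counit (R := ℂ) (m i j) = if i = j then 1 else 0)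
    (f : Fin n → A) (hfε : ∀ i, Coalgebra.counit (R := ℂ) (f i) = 0)
    (hf : ∀ k ∈ K, ∀ i, hitL pair k (f i) = ∑ j, pair k (m i j) • f j) (i : Fin n) :
    f i ∈ ABp Bsub := by
  let b : Fin n → A := fun j => ∑ p, HopfAlgebra.antipode ℂ (m j p) * f p
  have hfb : f i = ∑ j, m i j * b j := by
    simp only [b, Finset.mul_sum, ← mul_assoc]
    rw [Finset.sum_comm]
    simp [← Finset.sum_mul, sum_coefficient_mul_antipode hm hε]
  have hbε : ∀ j, Coalgebra.counit (R := ℂ) (b j) = 0 := by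
    intro j
    simp [b, hfε]
  have hhit : ∀ k ∈ K, ∀ j, hitL pair k (b j) = Coalgebra.counit (R := ℂ) k • b j := by
    intro k hk j
    obtain ⟨z, hz⟩ := hKcoideal k hk
    obtain ⟨s, rfl⟩ := TensorProduct.exists_finset z
    have hΔ : Coalgebra.comul (R := ℂ) k = ∑ i ∈ s, i.1 ⊗ₜ[ℂ] (i.2 : U) := by
      rw [← hz]
      simp
    have hcoef : ∀ q r, ∑ p, ∑ t ∈ s, pair t.1 (HopfAlgebra.antipode ℂ (m q p)) *
        pair (t.2 : U) (m p r) = if q = r then Coalgebra.counit (R := ℂ) k else 0 := by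
      intro q r
      have h := congrArg (pair k) (sum_antipode_mul_coefficient hm hε q r)
      rw [apply_ite (pair k), hpair_oneA, map_zero, map_sum] at h
      simpa [hpair_mulA, hΔ] using h
    calc hitL pair k (b j)
        = ∑ p, ∑ t ∈ s, (∑ q, pair t.1 (HopfAlgebra.antipode ℂ (m q p)) •
            HopfAlgebra.antipode ℂ (m j q)) * ∑ r, pair (t.2 : U) (m p r) • f r := by
          simp only [b, map_sum]
          refine Finset.sum_congr rfl fun p _ => ?_
          rw [hitL_mul pair hpair_mulA k s _ _ hΔ]
          refine Finset.sum_congr rfl fun t _ => ?_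
          rw [hf _ t.2.2, hitL_of_comul_eq pair _ _ _ _ (comul_antipode_coefficient hm hε j p)]
      _ = ∑ q, ∑ r, (∑ p, ∑ t ∈ s, pair t.1 (HopfAlgebra.antipode ℂ (m q p)) *
            pair (t.2 : U) (m p r)) • (HopfAlgebra.antipode ℂ (m j q) * f r) := by
          simp only [Finset.sum_mul_sum, smul_mul_smul_comm, Finset.sum_smul]
          simp only [Finset.sum_comm (s := s)]
          rw [Finset.sum_comm]
          exact Finset.sum_congr rfl fun q _ => Finset.sum_comm
      _ = Coalgebra.counit (R := ℂ) k • b j := by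
          simp [hcoef, b, Finset.smul_sum, ite_smul]
  have hbB : ∀ j, b j ∈ Bsub := by
    intro j
    rw [← Subalgebra.mem_toSubmodule, hB, invSubmodule, Submodule.mem_iInf]
    intro k
    rw [LinearMap.mem_ker, hitL_sub_algebraMap pair hpair_oneU, hhit k k.2, sub_self]
  rw [hfb]
  exact Submodule.sum_mem _ fun j _ => Submodule.subset_span ⟨_, b j, hbB j, hbε j, rfl⟩

end Equivariant

/-- Lemma `l-nondeg`.  The pairing `K × A/AB⁺ → ℂ` induced by the
Hopf pairing between `U` and `A` is nondegenerate. -/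
theorem pairing_K_AmodABplus_nondegenerate
    (pair : U →ₗ[ℂ] A →ₗ[ℂ] ℂ)
    (hpair_mulU : ∀ (x y : U) (a : A), pair (x * y) a =
      LinearMap.mul' ℂ ℂ (TensorProduct.map (pair x) (pair y) (Coalgebra.comul (R := ℂ) a)))
    (hpair_mulA : ∀ (x : U) (a b : A), pair x (a * b) =
      LinearMap.mul' ℂ ℂ (TensorProduct.map (pair.flip a) (pair.flip b)
        (Coalgebra.comul (R := ℂ) x)))
    (hpair_oneU : ∀ a : A, pair 1 a = Coalgebra.counit (R := ℂ) a)
    (hpair_oneA : ∀ x : U, pair x 1 = Coalgebra.counit (R := ℂ) x)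
    (hpair_antipode : ∀ (x : U) (a : A),
      pair (HopfAlgebra.antipode (R := ℂ) x) a = pair x (HopfAlgebra.antipode (R := ℂ) a))
    (hsep : ∀ x : U, (∀ a : A, pair x a = 0) → x = 0)
    (hSbij : Function.Bijective (HopfAlgebra.antipode (R := ℂ) (A := U)))
    (K : Subalgebra ℂ U)
    (hKcoideal : ∀ k ∈ K, Coalgebra.comul (R := ℂ) k ∈
      LinearMap.range (TensorProduct.map (LinearMap.id (R := ℂ) (M := U))
        (Subalgebra.toSubmodule K).subtype))
    (hAspan : ∀ a : A, a ∈ Submodule.span ℂ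
      {x : A | ∃ (n : ℕ) (ρ : U →ₐ[ℂ] Module.End ℂ (Fin n → ℂ))
        (φ : Module.Dual ℂ (Fin n → ℂ)) (v : Fin n → ℂ),
        (∀ (ψ : Module.Dual ℂ (Fin n → ℂ)) (w : Fin n → ℂ),
          ∃ c : A, ∀ u : U, pair u c = ψ (ρ u w)) ∧
        ∀ u : U, pair u x = φ (ρ u v)})
    (hsemis : ∀ (n : ℕ) (ρ : U →ₐ[ℂ] Module.End ℂ (Fin n → ℂ)),
      (∀ (ψ : Module.Dual ℂ (Fin n → ℂ)) (w : Fin n → ℂ),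
        ∃ c : A, ∀ u : U, pair u c = ψ (ρ u w)) →
      ∀ W : Submodule ℂ (Fin n → ℂ), (∀ k ∈ K, ∀ w ∈ W, ρ k w ∈ W) →
        ∃ W' : Submodule ℂ (Fin n → ℂ), (∀ k ∈ K, ∀ w ∈ W', ρ k w ∈ W') ∧ IsCompl W W')
    (Bsub : Subalgebra ℂ A)
    (hB : Subalgebra.toSubmodule Bsub = invSubmodule pair K)
    :
    (∀ k ∈ K, (∀ a : A, pair k a = 0) → k = 0) ∧
    (∀ a : A, (∀ k ∈ K, pair k a = 0) → a ∈ ABp Bsub) := by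
  refine ⟨fun k _ h => hsep k h, fun a ha => ?_⟩
  obtain ⟨n, e, m, x, hx, he, hm, hε⟩ := exists_matrix_coefficients a
  let ρ := coefficientRep pair hpair_mulU hpair_oneU hm hε
  have hρ : ∀ u w i, ρ u w i = ∑ j, pair u (m i j) * w j := by
    intro u w i
    simp [ρ, coefficientRep, Matrix.mulVec, dotProduct]
  let J : Submodule ℂ A := ⨅ k : K, LinearMap.ker (pair k)
  have hJ : ∀ y, y ∈ J ↔ ∀ k ∈ K, pair k y = 0 := by
    intro y
    simp [J, Submodule.mem_iInf]
  let L : Module.Dual ℂ (Fin n → ℂ) →ₗ[ℂ] A :=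
    ∑ i, (LinearMap.toSpanSingleton ℂ A (e i)) ∘ₗ
      (LinearMap.applyₗ (Pi.single i (1 : ℂ)) : Module.Dual ℂ (Fin n → ℂ) →ₗ[ℂ] ℂ)
  have hL : ∀ ψ, L ψ = ∑ i, ψ (Pi.single i 1) • e i := by
    intro ψ
    simp [L]
  have hhitL : ∀ u ψ, hitL pair u (L ψ) = L (ψ ∘ₗ ρ u) := by
    intro u ψ
    have hψ : ∀ w : Fin n → ℂ, ψ w = ∑ i, w i * ψ (Pi.single i 1) := fun w => by
      conv_lhs => rw [← Finset.univ_sum_single w]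
      rw [map_sum]
      refine Finset.sum_congr rfl fun i _ => ?_
      rw [← smul_eq_mul, ← map_smul, ← Pi.single_smul, smul_eq_mul, mul_one]
    simp only [hL, map_sum, map_smul, hitL_of_comul_eq pair u _ _ _ (he _), LinearMap.comp_apply]
    simp only [Finset.smul_sum, smul_smul]
    rw [Finset.sum_comm]
    refine Finset.sum_congr rfl fun j _ => ?_
    rw [hψ, Finset.sum_smul]
    refine Finset.sum_congr rfl fun i _ => ?_
    simp [hρ, Pi.single_apply, mul_comm]
  let N : Submodule ℂ (Module.Dual ℂ (Fin n → ℂ)) := J.comap L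
  have hNstable : ∀ k ∈ K, ∀ ψ ∈ N, ψ ∘ₗ ρ k ∈ N := by
    intro k hk ψ hψ
    rw [Submodule.mem_comap, hJ] at hψ ⊢
    intro l hl
    rw [← hhitL, pair_hitL pair hpair_mulU]
    exact hψ _ (K.mul_mem hk hl)
  let W : Submodule ℂ (Fin n → ℂ) := N.dualCoannihilator
  have hWN : W.dualAnnihilator = N := Subspace.dualCoannihilator_dualAnnihilator_eq
  have hW : ∀ k ∈ K, ∀ w ∈ W, ρ k w ∈ W := by
    intro k hk w hw
    rw [Submodule.mem_dualCoannihilator] at hw ⊢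
    exact fun ψ hψ => hw _ (hNstable k hk ψ hψ)
  obtain ⟨W', hW', hc⟩ := hsemis n ρ (fun ψ w => by
    refine ⟨∑ i, ∑ j, (ψ (Pi.single i 1) * w j) • m i j, fun u => ?_⟩
    conv_rhs => rw [← Finset.univ_sum_single (ρ u w)]
    simp only [map_sum, map_smul]
    refine Finset.sum_congr rfl fun i _ => ?_
    have h : (Pi.single i (ρ u w i) : Fin n → ℂ) = ρ u w i • Pi.single i 1 := by
      rw [← Pi.single_smul, smul_eq_mul, mul_one]
    rw [h, map_smul, hρ, smul_eq_mul, Finset.sum_mul]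
    refine Finset.sum_congr rfl fun j _ => ?_
    rw [smul_eq_mul]
    ring) W hW
  let P : (Fin n → ℂ) →ₗ[ℂ] (Fin n → ℂ) := W'.projection W hc.symm
  have hPW : ∀ w ∈ W, P w = 0 := fun w hw =>
    Submodule.projection_apply_of_mem_right hc.symm hw
  have hPW' : ∀ w ∈ W', P w = w := fun w hw =>
    Submodule.projection_apply_of_mem_left hc.symm hw
  have hdecomp : ∀ w, ∃ w₁ ∈ W, ∃ w₂ ∈ W', w = w₁ + w₂ := by
    intro w
    obtain ⟨w₁, h₁, w₂, h₂, h⟩ := Submodule.mem_sup.1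
      (hc.sup_eq_top ▸ Submodule.mem_top : w ∈ W ⊔ W')
    exact ⟨w₁, h₁, w₂, h₂, h.symm⟩
  have hPρ : ∀ k ∈ K, P ∘ₗ ρ k = ρ k ∘ₗ P := by
    intro k hk
    refine LinearMap.ext fun w => ?_
    obtain ⟨w₁, h₁, w₂, h₂, rfl⟩ := hdecomp w
    simp [hPW w₁ h₁, hPW' w₂ h₂, hPW _ (hW k hk w₁ h₁), hPW' _ (hW' k hk w₂ h₂)]
  have hPN : ∀ ψ, ψ ∘ₗ P ∈ N := by
    intro ψ
    rw [← hWN, Submodule.mem_dualAnnihilator]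
    intro w hw
    rw [LinearMap.comp_apply, hPW w hw, map_zero]
  have hNP : ∀ ψ ∈ N, ψ ∘ₗ P = ψ := by
    intro ψ hψ
    refine LinearMap.ext fun w => ?_
    obtain ⟨w₁, h₁, w₂, h₂, rfl⟩ := hdecomp w
    have h : ψ w₁ = 0 := (Submodule.mem_dualCoannihilator _).1 h₁ ψ hψ
    simp [hPW w₁ h₁, hPW' w₂ h₂, h]
  let f : Fin n → A := fun i => L (LinearMap.proj i ∘ₗ P)
  have hfε : ∀ i, Coalgebra.counit (R := ℂ) (f i) = 0 := fun i => by
    rw [← hpair_oneU]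
    exact (hJ _).1 (hPN _) 1 K.one_mem
  have hf : ∀ k ∈ K, ∀ i, hitL pair k (f i) = ∑ j, pair k (m i j) • f j := by
    intro k hk i
    simp only [f]
    rw [hhitL, LinearMap.comp_assoc, hPρ k hk]
    simp only [← map_smul, ← map_sum]
    congr 1
    refine LinearMap.ext fun w => ?_
    simp [hρ, LinearMap.sum_apply]
  let ξ : Module.Dual ℂ (Fin n → ℂ) := ∑ i, x i • LinearMap.proj i
  have hξ : L ξ = a := by
    rw [hx, hL]
    refine Finset.sum_congr rfl fun i _ => ?_
    simp [ξ, LinearMap.sum_apply, Pi.single_apply]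
  have hξN : ξ ∈ N := by
    rw [Submodule.mem_comap, hξ, hJ]
    exact ha
  have haf : a = ∑ i, x i • f i := by
    rw [← hξ, ← hNP ξ hξN]
    simp only [f, ← map_smul, ← map_sum]
    congr 1
    refine LinearMap.ext fun w => ?_
    simp [ξ]
  rw [haf]
  exact Submodule.sum_mem _ fun i _ => Submodule.smul_mem _ _ <|
    mem_ABp_of_equivariant pair hpair_mulA hpair_oneU hpair_oneA K hKcoideal Bsub hB hm hε f hfε hf i
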